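/- Let γ₀,…,γ_k be elements with γ_i ∈ P_{n_i,r_i}, and let ω and ω' be elements of SH(r₀,…,r_k) with ω ≤_B ω' in the weak Bruhat order of P_{r₀+…+r_k}. Then ω∘(γ₀×…×γ_k) ≤_B ω'∘(γ₀×…×γ_k) in the weak Bruhat order of P_{n₀+…+n_k}. -/

import Mathlib

namespace PaperP

/-- `IsPF n r f` : `f` represents a surjective map `{1,…,n} → {1,…,r}` (an element of
`P_{n,r}`), normalized so that `f v = 0` for `v ∉ {1,…,n}`. -/
def IsPF (n r : ℕ) (f : ℕ → ℕ) : Prop :=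
  (∀ v : ℕ, f v ≠ 0 ↔ (1 ≤ v ∧ v ≤ n)) ∧ f '' Set.Icc 1 n = Set.Icc 1 r

/-- The product `γ × δ ∈ P_{n+m,r+s}` of `γ ∈ P_{n,r}` and `δ ∈ P_{m,s}`:
`(γ×δ)(i) = γ(i)` for `1 ≤ i ≤ n` and `(γ×δ)(n+i) = δ(i)+r` for `1 ≤ i ≤ m`. -/
def prodF (n r : ℕ) (f g : ℕ → ℕ) : ℕ → ℕ := fun v =>
  if v ≤ n then f v else if g (v - n) = 0 then 0 else g (v - n) + r

/-- The identity map `1_r` of `{1,…,r}`. -/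
def idF (r : ℕ) : ℕ → ℕ := fun v => if 1 ≤ v ∧ v ≤ r then v else 0

/-- The map `t_i ∈ P_{r,r-1}` : `t_i(j) = j` for `j ≤ i` and `t_i(j) = j-1` for `j > i`. -/
def tF (r i : ℕ) : ℕ → ℕ := fun v =>
  if 1 ≤ v ∧ v ≤ r then (if v ≤ i then v else v - 1) else 0

/-- The block-increasing condition: `γ` is increasing on each of the consecutive blocks of
sizes `ns = (n₁,…,n_r)` (positions are 1-based). -/
def BlockIncr (ns : List ℕ) (f : ℕ → ℕ) : Prop :=
  ∀ j < ns.length, ∀ a b : ℕ, (ns.take j).sum < a → a < b → b ≤ (ns.take (j + 1)).sum →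
    f a < f b

/-- Membership in the set of shuffles `SH(n₁,…,n_r) ⊆ P_n`, `n = n₁+…+n_r`. -/
def InSH (ns : List ℕ) (f : ℕ → ℕ) : Prop :=
  (∃ r : ℕ, IsPF ns.sum r f) ∧ BlockIncr ns f

/-- `γ⁻¹(i) < γ⁻¹(i+1)` : every element of `γ⁻¹(i)` is smaller than every element of
`γ⁻¹(i+1)`. -/
def InvIncr (f : ℕ → ℕ) (i : ℕ) : Prop := ∀ a b : ℕ, f a = i → f b = i + 1 → a < b

/-- `γ⁻¹(i) > γ⁻¹(i+1)` : every element of `γ⁻¹(i)` is larger than every element of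
`γ⁻¹(i+1)`. -/
def InvDecr (f : ℕ → ℕ) (i : ℕ) : Prop := ∀ a b : ℕ, f a = i → f b = i + 1 → b < a

/-- One covering step of the weak Bruhat order on `P_n` :
`γ <_B t_i ∘ γ` when `γ⁻¹(i) < γ⁻¹(i+1)`, and `t_i ∘ γ <_B γ` when `γ⁻¹(i) > γ⁻¹(i+1)`,
for `γ ∈ P_{n,r}` and `1 ≤ i ≤ r-1`. -/
def BStep (n : ℕ) (f g : ℕ → ℕ) : Prop :=
  ∃ r i : ℕ, 1 ≤ i ∧ i + 1 ≤ r ∧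
    ((IsPF n r f ∧ InvIncr f i ∧ g = tF r i ∘ f) ∨
     (IsPF n r g ∧ InvDecr g i ∧ f = tF r i ∘ g))

/-- The weak Bruhat order `≤_B` on `P_n`, the reflexive-transitive closure of `BStep`. -/
def BLE (n : ℕ) : (ℕ → ℕ) → (ℕ → ℕ) → Prop := Relation.ReflTransGen (BStep n)

/-- Turn a (1-based) list of values into a normalized map `ℕ → ℕ`. -/
def ofList (l : List ℕ) : ℕ → ℕ := fun v => if v = 0 then 0 else l.getD (v - 1) 0

/-- The maximal shuffle `ξ_{n₁,…,n_r}` :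
`ξ(k) = k - (n₁+…+n_{j-1}) + (n_{j+1}+…+n_r)` for `n₁+…+n_{j-1} < k ≤ n₁+…+n_j`. -/
def xiF : List ℕ → ℕ → ℕ
  | [], _ => 0
  | m :: rest, k =>
      if k = 0 then 0 else if k ≤ m then k + rest.sum else xiF rest (k - m)

/-- The list `z(n₀,…,n_k) = (1,…,n₀, n+1, n₀+1,…,n₀+n₁, n+1, …, n+1, n₀+…+n_{k-1}+1,…,n)`
where `n = n₀+…+n_k` (built with an accumulator `start`). -/
def zList (n : ℕ) : ℕ → List ℕ → List ℕ
  | _, [] => []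
  | start, [m] => List.range' (start + 1) m
  | start, m :: rest => List.range' (start + 1) m ++ (n + 1) :: zList n (start + m) rest

/-- `z(n₀,…,n_k)` as a normalized map. -/
def zF (ns : List ℕ) : ℕ → ℕ := ofList (zList ns.sum 0 ns)

/-- The iterated product `γ₀ × … × γ_k` of a family, each member given as a triple
`(nᵢ, rᵢ, γᵢ)` with `γᵢ ∈ P_{nᵢ,rᵢ}`; returns `(Σnᵢ, Σrᵢ, γ₀×…×γ_k)`. -/
def prodFam : List (ℕ × ℕ × (ℕ → ℕ)) → ℕ × ℕ × (ℕ → ℕ)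
  | [] => (0, 0, fun _ => 0)
  | (n, r, f) :: rest =>
      let p := prodFam rest
      (n + p.1, r + p.2.1, prodF n r f p.2.2)

/-- The wedge `⋁_ω(γ₀,…,γ_k) = ((ω ∘ (γ₀×…×γ_k)) × 1₁) ∘ z(n₀,…,n_k)` of a family
`γᵢ ∈ P_{nᵢ,rᵢ}` over a shuffle `ω ∈ SH(r₀,…,r_k)`. -/
def wedgeF (ω : ℕ → ℕ) (fam : List (ℕ × ℕ × (ℕ → ℕ))) : ℕ → ℕ :=
  prodF (prodFam fam).1 (prodFam fam).2.1 (ω ∘ (prodFam fam).2.2) (idF 1) ∘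
    zF (fam.map (·.1))

theorem IsPF.le {n r : ℕ} {f : ℕ → ℕ} (hf : IsPF n r f) (v : ℕ) : f v ≤ r := by
  by_cases h : f v = 0
  · omega
  · have hv : f v ∈ f '' Set.Icc 1 n := ⟨v, (hf.1 v).1 h, rfl⟩
    rw [hf.2] at hv
    exact hv.2

theorem IsPF.comp {n r s : ℕ} {f g : ℕ → ℕ} (hg : IsPF r s g) (hf : IsPF n r f) :
    IsPF n s (g ∘ f) := by
  refine ⟨fun v => ?_, by rw [Set.image_comp, hf.2, hg.2]⟩
  have hle := hf.le v
  rw [Function.comp_apply, hg.1, ← hf.1]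
  omega

theorem IsPF.prodF {n r m s : ℕ} {f g : ℕ → ℕ} (hf : IsPF n r f) (hg : IsPF m s g) :
    IsPF (n + m) (r + s) (prodF n r f g) := by
  have hsupp : ∀ v, PaperP.prodF n r f g v ≠ 0 ↔ (1 ≤ v ∧ v ≤ n + m) := by
    intro v
    have hfv := hf.1 v
    have hgv := hg.1 (v - n)
    unfold PaperP.prodF
    split_ifs <;> omega
  refine ⟨hsupp, Set.Subset.antisymm ?_ ?_⟩
  · rintro _ ⟨v, hv, rfl⟩
    have hpos := (hsupp v).2 hv
    refine ⟨by omega, ?_⟩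
    have hfv := hf.le v
    have hgv := hg.le (v - n)
    unfold PaperP.prodF
    split_ifs <;> omega
  · rintro w ⟨hw1, hw2⟩
    by_cases hw : w ≤ r
    · obtain ⟨v, hv, rfl⟩ : w ∈ f '' Set.Icc 1 n := hf.2 ▸ ⟨hw1, hw⟩
      obtain ⟨hv1, hv2⟩ := hv
      exact ⟨v, ⟨hv1, by omega⟩, by simp [PaperP.prodF, hv2]⟩
    · obtain ⟨v, ⟨hv1, hv2⟩, hvw⟩ : w - r ∈ g '' Set.Icc 1 m :=
        hg.2 ▸ ⟨by omega, by omega⟩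
      refine ⟨n + v, ⟨by omega, by omega⟩, ?_⟩
      have hsub : n + v - n = v := by omega
      unfold PaperP.prodF
      rw [hsub, hvw]
      split_ifs <;> omega

theorem isPF_prodFam (fam : List (ℕ × ℕ × (ℕ → ℕ)))
    (hfam : ∀ x ∈ fam, IsPF x.1 x.2.1 x.2.2) :
    IsPF (fam.map (·.1)).sum (fam.map (·.2.1)).sum (prodFam fam).2.2 ∧
      (prodFam fam).1 = (fam.map (·.1)).sum ∧ (prodFam fam).2.1 = (fam.map (·.2.1)).sum := by
  induction fam with
  | nil =>
    refine ⟨⟨fun v => ?_, ?_⟩, rfl, rfl⟩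
    · simp only [prodFam, List.map_nil, List.sum_nil]
      omega
    · simp
  | cons x rest ih =>
    obtain ⟨h1, h2, h3⟩ := ih fun y hy => hfam y (List.mem_cons_of_mem _ hy)
    obtain ⟨n, r, f⟩ := x
    have hx : IsPF n r f := hfam (n, r, f) List.mem_cons_self
    simpa [prodFam, h2, h3] using hx.prodF h1

theorem BlockIncr.head {n : ℕ} {ns : List ℕ} {f : ℕ → ℕ} (h : BlockIncr (n :: ns) f)
    {a b : ℕ} (ha : 0 < a) (hab : a < b) (hb : b ≤ n) : f a < f b :=
  h 0 (by simp) a b (by simpa using ha) hab (by simpa using hb)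

theorem BlockIncr.tail {n : ℕ} {ns : List ℕ} {f : ℕ → ℕ} (h : BlockIncr (n :: ns) f) :
    BlockIncr ns fun v => f (v + n) := by
  intro j hj a b ha hab hb
  refine h (j + 1) (by simpa using hj) (a + n) (b + n) ?_ (by omega) ?_
  · simp only [List.take_succ_cons, List.sum_cons]
    omega
  · simp only [List.take_succ_cons, List.sum_cons] at hb ⊢
    omega

/-- A product of maps is order-reflecting on values which a block-increasing map does not
separate in increasing order, since such values lie in different blocks. -/
theorem lt_of_prodFam_lt (fam : List (ℕ × ℕ × (ℕ → ℕ)))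
    (hfam : ∀ x ∈ fam, IsPF x.1 x.2.1 x.2.2) (g : ℕ → ℕ)
    (hg : BlockIncr (fam.map (·.2.1)) g) (u v : ℕ) (hu : (prodFam fam).2.2 u ≠ 0)
    (huv : (prodFam fam).2.2 u < (prodFam fam).2.2 v)
    (hle : g ((prodFam fam).2.2 v) ≤ g ((prodFam fam).2.2 u)) : u < v := by
  induction fam generalizing g u v with
  | nil => exact absurd rfl hu
  | cons x rest ih =>
    obtain ⟨n, r, f⟩ := x
    have hx : IsPF n r f := hfam (n, r, f) List.mem_cons_self
    have ih := ih (fun y hy => hfam y (List.mem_cons_of_mem _ hy)) (fun w => g (w + r)) hg.tail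
      (u - n) (v - n)
    have hhead : ∀ {a b : ℕ}, 0 < a → a < b → b ≤ r → g a < g b := BlockIncr.head hg
    simp only [prodFam, prodF] at hu huv hle
    have hfv := hx.le v
    by_cases hun : u ≤ n
    · by_cases hvn : v ≤ n
      · simp only [hun, hvn, if_true] at hu huv hle
        have := hhead (by omega) huv hfv
        omega
      · omega
    · by_cases hu0 : (prodFam rest).2.2 (u - n) = 0
      · simp [hun, hu0] at hu
      by_cases hvn : v ≤ n
      · simp only [hun, hvn, hu0, if_true, if_false] at huv
        omega
      · by_cases hv0 : (prodFam rest).2.2 (v - n) = 0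
        · simp [hun, hvn, hv0] at huv
        simp only [hun, hvn, hu0, hv0, if_false] at huv hle
        have := ih hu0 (by omega) hle
        omega

theorem tF_eq_of_consecutive {r i : ℕ} (hi : 1 ≤ i) (hir : i + 1 ≤ r) :
    tF r i (i + 1) = tF r i i := by
  unfold tF
  split_ifs <;> omega

theorem tF_lt_tF_of_lt {r i x y : ℕ} (hy : y ≤ r) (hxy : x < y) (h : ¬ (x = i ∧ y = i + 1))
    (hi : 1 ≤ i) : tF r i x < tF r i y := by
  unfold tF
  split_ifs <;> omega

theorem lt_of_tF_lt_tF {r i x y : ℕ} (hx : x ≤ r) (h : tF r i x < tF r i y) : x < y := by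
  unfold tF at h
  split_ifs at h <;> omega

/-- Shuffles are closed downwards in the weak Bruhat order. -/
theorem BStep.blockIncr {ns : List ℕ} {n : ℕ} {f g : ℕ → ℕ} (h : BStep n f g)
    (hg : BlockIncr ns g) : BlockIncr ns f := by
  intro j hj a b ha hab hb
  have hlt := hg j hj a b ha hab hb
  obtain ⟨r, i, hi, hir, ⟨hf, -, rfl⟩ | ⟨hg', hdec, rfl⟩⟩ := h
  · exact lt_of_tF_lt_tF (hf.le a) hlt
  · refine tF_lt_tF_of_lt (hg'.le b) hlt (fun ⟨h1, h2⟩ => ?_) hi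
    have := hdec a b h1 h2
    omega

theorem BStep.comp_prodFam {fam : List (ℕ × ℕ × (ℕ → ℕ))}
    (hfam : ∀ x ∈ fam, IsPF x.1 x.2.1 x.2.2) {f g : ℕ → ℕ}
    (h : BStep (fam.map (·.2.1)).sum f g) (hg : BlockIncr (fam.map (·.2.1)) g) :
    BStep (fam.map (·.1)).sum (f ∘ (prodFam fam).2.2) (g ∘ (prodFam fam).2.2) := by
  have hp := (isPF_prodFam fam hfam).1
  obtain ⟨r, i, hi, hir, ⟨hf, hinc, rfl⟩ | ⟨hg', hdec, rfl⟩⟩ := h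
  · refine ⟨r, i, hi, hir, Or.inl ⟨hf.comp hp, fun u v hu hv => ?_, rfl⟩⟩
    simp only [Function.comp_apply] at hu hv
    have hpos := (hf.1 ((prodFam fam).2.2 u)).1 (by omega)
    refine lt_of_prodFam_lt fam hfam _ hg u v (by omega) (hinc _ _ hu hv) ?_
    simp only [Function.comp_apply, hu, hv]
    exact (tF_eq_of_consecutive hi hir).le
  · refine ⟨r, i, hi, hir, Or.inr ⟨hg'.comp hp, fun u v hu hv => ?_, rfl⟩⟩
    simp only [Function.comp_apply] at hu hv
    have hpos := (hg'.1 ((prodFam fam).2.2 v)).1 (by omega)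
    exact lt_of_prodFam_lt fam hfam _ hg v u (by omega) (hdec _ _ hu hv) (by omega)

/-- if `ω ≤_B ω'` in `SH(r₀,…,r_k)`, then
`ω ∘ (γ₀×…×γ_k) ≤_B ω' ∘ (γ₀×…×γ_k)` in `P_{n₀+…+n_k}`, for `γᵢ ∈ P_{nᵢ,rᵢ}`.
The family is encoded as a list `fam` of triples `(nᵢ, rᵢ, γᵢ)`. -/
theorem comp_shuffle_mono_weak_order (fam : List (ℕ × ℕ × (ℕ → ℕ))) (hne : fam ≠ [])
    (hfam : ∀ x ∈ fam, IsPF x.1 x.2.1 x.2.2)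
    (ω ω' : ℕ → ℕ)
    (hω : InSH (fam.map (·.2.1)) ω) (hω' : InSH (fam.map (·.2.1)) ω')
    (h : BLE ((fam.map (·.2.1)).sum) ω ω') :
    BLE ((fam.map (·.1)).sum) (ω ∘ (prodFam fam).2.2) (ω' ∘ (prodFam fam).2.2) := by
  have hω'_incr := hω'.2
  clear hω hω'
  induction h with
  | refl => exact Relation.ReflTransGen.refl
  | tail _ hstep ih =>
    exact (ih (hstep.blockIncr hω'_incr)).tail (hstep.comp_prodFam hfam hω'_incr)

end PaperP
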